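/- Let H₀ and H₁ be complex Hilbert spaces and C : dom(C) ⊆ H₀ → H₁ a densely defined closed linear operator. If every sequence (xₙ) in dom(C) ∩ ker(C)^⊥ with supₙ(‖xₙ‖ + ‖Cxₙ‖) < ∞ has a subsequence converging in H₀, then ran(C) is closed in H₁. -/

import Mathlib

open Complex Filter
open scoped InnerProductSpace

/-- `ker C` as a submodule of the ambient space. -/
def kerSub {H₀ H₁ : Type*} [NormedAddCommGroup H₀] [InnerProductSpace ℂ H₀]
    [NormedAddCommGroup H₁] [InnerProductSpace ℂ H₁] (C : H₀ →ₗ.[ℂ] H₁) : Submodule ℂ H₀ :=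
  (LinearMap.ker C.toFun).map C.domain.subtype

/-- A vector lies in the kernel of `C` iff its pair with `0` lies in the graph. -/
theorem mem_kerSub_iff {H₀ H₁ : Type*} [NormedAddCommGroup H₀] [InnerProductSpace ℂ H₀]
    [NormedAddCommGroup H₁] [InnerProductSpace ℂ H₁] (C : H₀ →ₗ.[ℂ] H₁) (x : H₀) :
    x ∈ kerSub C ↔ (x, (0 : H₁)) ∈ C.graph := by
  rw [LinearPMap.mem_graph_iff, kerSub, Submodule.mem_map]
  exact ⟨fun ⟨y, hy, h⟩ => ⟨y, h, hy⟩, fun ⟨y, h, hy⟩ => ⟨y, hy, h⟩⟩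

/-- The kernel of a closed operator is closed. -/
theorem isClosed_kerSub {H₀ H₁ : Type*} [NormedAddCommGroup H₀] [InnerProductSpace ℂ H₀]
    [NormedAddCommGroup H₁] [InnerProductSpace ℂ H₁] (C : H₀ →ₗ.[ℂ] H₁)
    (hC : IsClosed (C.graph : Set (H₀ × H₁))) : IsClosed (kerSub C : Set H₀) := by
  have h : (kerSub C : Set H₀) = (fun x => (x, (0 : H₁))) ⁻¹' (C.graph : Set (H₀ × H₁)) :=
    Set.ext (mem_kerSub_iff C)
  rw [h]
  exact hC.preimage (by fun_prop)

/-- If bounded sequences in `dom C ∩ (ker C)ᗮ` have convergent subsequences, then the closed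
operator `C` is bounded below on `dom C ∩ (ker C)ᗮ`. -/
theorem exists_norm_le_mul_norm_apply {H₀ H₁ : Type*}
    [NormedAddCommGroup H₀] [InnerProductSpace ℂ H₀]
    [NormedAddCommGroup H₁] [InnerProductSpace ℂ H₁] (C : H₀ →ₗ.[ℂ] H₁)
    (hC : IsClosed (C.graph : Set (H₀ × H₁)))
    (hcpt : ∀ x : ℕ → C.domain, (∀ n, (x n : H₀) ∈ (kerSub C)ᗮ) →
      (∃ M : ℝ, ∀ n, ‖(x n : H₀)‖ + ‖C (x n)‖ ≤ M) →
      ∃ (φ : ℕ → ℕ) (l : H₀), StrictMono φ ∧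
        Tendsto (fun n => ((x (φ n) : H₀))) atTop (nhds l)) :
    ∃ c : ℕ, ∀ x : C.domain, (x : H₀) ∈ (kerSub C)ᗮ → ‖(x : H₀)‖ ≤ c * ‖C x‖ := by
  by_contra! hne
  choose x hxK hx using fun n : ℕ => hne (n + 1)
  have hpos (n : ℕ) : 0 < ‖(x n : H₀)‖ := lt_of_le_of_lt (by positivity) (hx n)
  let z (n : ℕ) : C.domain := ((‖(x n : H₀)‖⁻¹ : ℝ) : ℂ) • x n
  have hzK (n : ℕ) : (z n : H₀) ∈ (kerSub C)ᗮ := Submodule.smul_mem _ _ (hxK n)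
  have hznorm (n : ℕ) : ‖(z n : H₀)‖ = 1 := by
    simp [z, norm_smul, inv_mul_cancel₀ (hpos n).ne']
  have hCz (n : ℕ) : ‖C (z n)‖ ≤ 1 / ((n : ℝ) + 1) := by
    have h := hx n
    push_cast at h
    rw [LinearPMap.map_smul, norm_smul, Complex.norm_real, norm_inv, norm_norm,
      inv_mul_eq_div, div_le_div_iff₀ (hpos n) (by positivity)]
    linarith
  obtain ⟨φ, l, hφ, hl⟩ := hcpt z hzK ⟨2, fun n => by
    have h : 1 / ((n : ℝ) + 1) ≤ 1 := by
      rw [div_le_one (by positivity)]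
      linarith [n.cast_nonneg (α := ℝ)]
    linarith [hznorm n, hCz n]⟩
  have hC0 : Tendsto (fun n => C (z n)) atTop (nhds 0) :=
    squeeze_zero_norm hCz tendsto_one_div_add_atTop_nhds_zero_nat
  have hlK : l ∈ kerSub C := (mem_kerSub_iff C l).2 <|
    hC.mem_of_tendsto (hl.prodMk_nhds (hC0.comp hφ.tendsto_atTop))
      (Eventually.of_forall fun n => C.mem_graph (z (φ n)))
  have hlK' : l ∈ (kerSub C)ᗮ :=
    (kerSub C).isClosed_orthogonal.mem_of_tendsto hl (Eventually.of_forall fun n => hzK (φ n))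
  have hl0 : l = 0 := (Submodule.disjoint_def.1 (kerSub C).orthogonal_disjoint) l hlK hlK'
  have hl1 : ‖l‖ = 1 := tendsto_nhds_unique hl.norm (by simp [hznorm])
  simp [hl0] at hl1

/-- Let `C` be densely defined and closed. If every sequence in
`dom C ∩ (ker C)ᗮ` bounded in the graph norm has a subsequence converging in `H₀`,
then `ran C` is closed in `H₁`. -/
theorem stmt_17
    {H₀ H₁ : Type*} [NormedAddCommGroup H₀] [InnerProductSpace ℂ H₀] [CompleteSpace H₀]
    [NormedAddCommGroup H₁] [InnerProductSpace ℂ H₁] [CompleteSpace H₁]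
    (C : H₀ →ₗ.[ℂ] H₁)
    (hdense : Dense (C.domain : Set H₀))
    (hCclosed : IsClosed (C.graph : Set (H₀ × H₁)))
    (hcpt : ∀ x : ℕ → C.domain, (∀ n, (x n : H₀) ∈ (kerSub C)ᗮ) →
      (∃ M : ℝ, ∀ n, ‖(x n : H₀)‖ + ‖C (x n)‖ ≤ M) →
      ∃ (φ : ℕ → ℕ) (l : H₀), StrictMono φ ∧
        Tendsto (fun n => ((x (φ n) : H₀))) atTop (nhds l)) :
    IsClosed ((LinearMap.range C.toFun : Submodule ℂ H₁) : Set H₁) := by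
  obtain ⟨c, hc⟩ := exists_norm_le_mul_norm_apply C hCclosed hcpt
  have : CompleteSpace (kerSub C) := (isClosed_kerSub C hCclosed).completeSpace_coe
  let S : Submodule ℂ (H₀ × H₁) := C.graph ⊓ (kerSub C)ᗮ.comap (LinearMap.fst ℂ H₀ H₁)
  have hS : IsClosed (S : Set (H₀ × H₁)) :=
    hCclosed.inter ((kerSub C).isClosed_orthogonal.preimage continuous_fst)
  have : CompleteSpace S := hS.completeSpace_coe
  let f : S →L[ℂ] H₁ := (ContinuousLinearMap.snd ℂ H₀ H₁).comp S.subtypeL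
  have hf : AntilipschitzWith (c + 1) f := by
    refine f.antilipschitz_of_bound fun ⟨⟨x, y⟩, hxy, hxK⟩ => ?_
    obtain ⟨u, rfl, rfl⟩ := (LinearPMap.mem_graph_iff C).1 hxy
    have h := hc u hxK
    change max ‖(u : H₀)‖ ‖C u‖ ≤ ((c + 1 : NNReal) : ℝ) * ‖C u‖
    push_cast
    refine max_le ?_ ?_ <;> nlinarith [norm_nonneg (C u), c.cast_nonneg (α := ℝ)]
  convert hf.isClosed_range f.uniformContinuous using 1
  ext y
  constructor
  · rintro ⟨u, rfl⟩
    obtain ⟨k, hk, v, hv, huv⟩ := (kerSub C).exists_add_mem_mem_orthogonal (u : H₀)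
    have hvg : (v, C u) ∈ C.graph := by
      have h := C.graph.sub_mem (C.mem_graph u) ((mem_kerSub_iff C k).1 hk)
      simpa [huv] using h
    exact ⟨⟨(v, C u), hvg, hv⟩, rfl⟩
  · rintro ⟨⟨⟨x, y⟩, hxy, -⟩, rfl⟩
    obtain ⟨u, -, hu⟩ := (LinearPMap.mem_graph_iff C).1 hxy
    exact ⟨u, hu⟩
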